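/- arXiv:1805.03350 — 3 statements merged into one kernel-verified Lean document; each statement's English description precedes it below -/
import Mathlib

section
/- In the evolving data model, if a round of insertion sort starts at time t_s and finishes at time t_e, then for every time t with t_s ≤ t ≤ t_e the number of inversions satisfies I_t − I_{t_s} < n. This holds deterministically, for every realization of the random adjacent swaps in l'. -/
open Finset

open scoped Classical

/-- State of the repeated insertion-sort algorithm in the evolving data model.
`perm` maps each position of the maintained list `l` to the position (rank) of
the element occupying it in the underlying ordered list `l'`;
`i` and `j` are the indices of the outer for-loop and inner while-loop. -/
structure InsState (n : ℕ) where
  perm : Equiv.Perm (Fin n)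
  i : ℕ
  j : ℕ

/-- Advance the outer for-loop; when `i` reaches `n - 1` a new round begins. -/
def nextI {n : ℕ} (s : InsState n) : InsState n :=
  if s.i + 1 < n then ⟨s.perm, s.i + 1, s.i + 1⟩ else ⟨s.perm, 1, 1⟩

/-- One comparison step of insertion sort (each such step takes one time unit). -/
def compStep {n : ℕ} (s : InsState n) : InsState n :=
  if h : 0 < s.j ∧ s.j < n then
    if s.perm ⟨s.j, h.2⟩ < s.perm ⟨s.j - 1, by omega⟩ then
      { perm := (Equiv.swap (⟨s.j, h.2⟩ : Fin n) ⟨s.j - 1, by omega⟩).trans s.perm,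
        i := s.i, j := s.j - 1 }
    else nextI s
  else nextI s

/-- The random adjacent swap in `l'`: elements of ranks `r` and `r + 1` are exchanged. -/
def randSwap {n : ℕ} (r : ℕ) (σ : Equiv.Perm (Fin n)) : Equiv.Perm (Fin n) :=
  if h : r + 1 < n then σ.trans (Equiv.swap ⟨r, by omega⟩ ⟨r + 1, h⟩) else σ

/-- Trajectory of the process: at each time step one comparison of the repeated
insertion sort is performed, followed by the random adjacent swap `ω t` in `l'`. -/
def run {n : ℕ} (init : Equiv.Perm (Fin n)) (ω : ℕ → ℕ) : ℕ → InsState n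
  | 0 => ⟨init, 1, 1⟩
  | t + 1 =>
    let s := compStep (run init ω t)
    ⟨randSwap (ω t) s.perm, s.i, s.j⟩

/-- Number of inversions of `σ`, i.e. the Kendall tau distance between `l` and `l'`. -/
def inversions {n : ℕ} (σ : Equiv.Perm (Fin n)) : ℕ :=
  (Finset.univ.filter fun p : Fin n × Fin n => p.1 < p.2 ∧ σ p.2 < σ p.1).card

/-- `I_t`, the Kendall tau distance between `l_t` and `l'_t`. -/
def invAt {n : ℕ} (init : Equiv.Perm (Fin n)) (ω : ℕ → ℕ) (t : ℕ) : ℕ :=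
  inversions (run init ω t).perm

/-- A round of insertion sort starts at time `t`. -/
def roundStart {n : ℕ} (init : Equiv.Perm (Fin n)) (ω : ℕ → ℕ) (t : ℕ) : Prop :=
  (run init ω t).i = 1 ∧ (run init ω t).j = 1

/-- A round of insertion sort starts at time `ts` and finishes at time `te`. -/
def isRound {n : ℕ} (init : Equiv.Perm (Fin n)) (ω : ℕ → ℕ) (ts te : ℕ) : Prop :=
  ts < te ∧ roundStart init ω ts ∧ roundStart init ω te ∧
    ∀ t, ts < t → t < te → ¬ roundStart init ω t

/-- Extend a finite sequence of adjacent-swap choices to an infinite one. -/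
def pad {m d : ℕ} (g : Fin m → Fin d) : ℕ → ℕ :=
  fun k => if h : k < m then (g ⟨k, h⟩ : ℕ) else 0

/-- Concatenate two finite sequences of adjacent-swap choices. -/
def pad2 {m₁ m₂ d : ℕ} (g : Fin m₁ → Fin d) (h : Fin m₂ → Fin d) : ℕ → ℕ :=
  fun k => if hk : k < m₁ then (g ⟨k, hk⟩ : ℕ)
    else if hk' : k - m₁ < m₂ then (h ⟨k - m₁, hk'⟩ : ℕ) else 0

/-- A transposition of two consecutive values preserves the order of every other pair. -/
lemma swap_lt_swap_of_succ {n : ℕ} {a b p q : Fin n} (hab : (b : ℕ) = a + 1) (hpq : p < q)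
    (hne : ¬ (p = a ∧ q = b)) : Equiv.swap a b p < Equiv.swap a b q := by
  simp only [Equiv.swap_apply_def]
  simp only [Fin.ext_iff, Fin.lt_def] at *
  split_ifs <;> simp_all <;> omega

/-- Exchanging two adjacent positions that are out of order removes an inversion. -/
lemma inversions_swap_trans_lt {n : ℕ} (σ : Equiv.Perm (Fin n)) {a b : Fin n}
    (hab : (b : ℕ) = a + 1) (hσ : σ b < σ a) :
    inversions ((Equiv.swap b a).trans σ) < inversions σ := by
  have hlt : a < b := by rw [Fin.lt_def]; omega
  rw [Equiv.swap_comm]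
  unfold inversions
  rw [← Finset.card_map ((Equiv.swap a b).prodCongr (Equiv.swap a b)).toEmbedding]
  apply Finset.card_lt_card
  rw [Finset.ssubset_iff_of_subset]
  · refine ⟨(a, b), by simp [hlt, hσ], ?_⟩
    rw [Finset.mem_map]
    rintro ⟨⟨p, q⟩, hp, he⟩
    simp only [Finset.mem_filter] at hp
    simp only [Equiv.coe_toEmbedding, Equiv.prodCongr_apply, Prod.map_apply, Prod.mk.injEq] at he
    rw [Equiv.swap_apply_eq_iff, Equiv.swap_apply_eq_iff, Equiv.swap_apply_left,
      Equiv.swap_apply_right] at he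
    rw [he.1, he.2] at hp
    exact lt_asymm hlt hp.2.1
  · intro x hx
    rw [Finset.mem_map] at hx
    obtain ⟨⟨p, q⟩, hp, rfl⟩ := hx
    simp only [Finset.mem_filter, Finset.mem_univ, true_and] at hp
    simp only [Equiv.trans_apply] at hp
    simp only [Finset.mem_filter, Finset.mem_univ, true_and, Equiv.coe_toEmbedding,
      Equiv.prodCongr_apply, Prod.map_apply]
    refine ⟨swap_lt_swap_of_succ hab hp.1 ?_, hp.2⟩
    rintro ⟨rfl, rfl⟩
    rw [Equiv.swap_apply_left, Equiv.swap_apply_right] at hp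
    exact lt_asymm hσ hp.2

/-- A random adjacent swap in the underlying order creates at most one inversion. -/
lemma inversions_randSwap_le {n : ℕ} (r : ℕ) (σ : Equiv.Perm (Fin n)) :
    inversions (randSwap r σ) ≤ inversions σ + 1 := by
  unfold randSwap
  split_ifs with h
  · unfold inversions
    refine (Finset.card_le_card ?_).trans
      (Finset.card_insert_le (σ.symm ⟨r, by omega⟩, σ.symm ⟨r + 1, h⟩) _)
    rintro ⟨p, q⟩ hp
    simp only [Finset.mem_filter, Finset.mem_univ, true_and] at hp
    simp only [Equiv.trans_apply] at hp
    simp only [Finset.mem_insert, Finset.mem_filter, Finset.mem_univ, true_and, Prod.mk.injEq,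
      Equiv.eq_symm_apply]
    by_contra! hc
    have hlt : σ p < σ q :=
      lt_of_le_of_ne (hc.2 hp.1) fun he => hp.1.ne (σ.injective he)
    exact lt_asymm hp.2 (swap_lt_swap_of_succ rfl hlt fun he => hc.1 he.1 he.2)
  · exact Nat.le_succ _

/-- A comparison step either removes an inversion and keeps the outer index, or leaves the
permutation unchanged and advances the outer loop. -/
lemma compStep_cases {n : ℕ} (s : InsState n) :
    (inversions (compStep s).perm < inversions s.perm ∧ (compStep s).i = s.i) ∨
      ((compStep s).perm = s.perm ∧ (compStep s).i = s.i + 1 ∧ s.i + 1 < n) ∨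
      ((compStep s).perm = s.perm ∧ (compStep s).i = 1 ∧ (compStep s).j = 1) := by
  unfold compStep
  split_ifs with h hlt
  · left
    exact ⟨inversions_swap_trans_lt s.perm (Nat.sub_add_cancel h.1).symm hlt, rfl⟩
  all_goals
    right
    unfold nextI
    split_ifs with hi
    · exact .inl ⟨rfl, rfl, hi⟩
    · exact .inr ⟨rfl, rfl, rfl⟩

/-- One time step either keeps the outer index without creating inversions, or advances the outer
loop and creates at most one inversion. -/
lemma invAt_succ_cases {n : ℕ} (init : Equiv.Perm (Fin n)) (ω : ℕ → ℕ) (t : ℕ) :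
    (invAt init ω (t + 1) ≤ invAt init ω t ∧ (run init ω (t + 1)).i = (run init ω t).i) ∨
      (invAt init ω (t + 1) ≤ invAt init ω t + 1 ∧
        (((run init ω (t + 1)).i = (run init ω t).i + 1 ∧ (run init ω t).i + 1 < n) ∨
          roundStart init ω (t + 1))) := by
  have hr := inversions_randSwap_le (ω t) (compStep (run init ω t)).perm
  rcases compStep_cases (run init ω t) with ⟨hv, hi⟩ | ⟨hp, hi⟩ | ⟨hp, hi⟩
  · exact .inl ⟨hr.trans hv, hi⟩
  · exact .inr ⟨hr.trans_eq (by rw [hp, invAt]), .inl hi⟩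
  · exact .inr ⟨hr.trans_eq (by rw [hp, invAt]), .inr hi⟩

/-- Strictly before the end of a round, the growth of the inversion count is less than the current
outer index, which stays below `n`. -/
lemma invAt_lt_add_outer_index {n : ℕ} (hn : 1 < n) {init : Equiv.Perm (Fin n)} {ω : ℕ → ℕ}
    {ts te : ℕ} (h : isRound init ω ts te) {t : ℕ} (hst : ts ≤ t) (hte : t < te) :
    invAt init ω t < invAt init ω ts + (run init ω t).i ∧ (run init ω t).i < n := by
  obtain ⟨-, hs, -, hno⟩ := h
  induction t, hst using Nat.le_induction with
  | base =>
    have := hs.1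
    omega
  | succ t hst ih =>
    have := ih (by omega)
    have := hno (t + 1) (by omega) hte
    rcases invAt_succ_cases init ω t with ⟨hv, hi⟩ | ⟨hv, hi | hi⟩
    · omega
    · omega
    · contradiction

/-- If a round of insertion sort starts at time `ts` and finishes at
time `te`, then for every time `t` with `ts ≤ t ≤ te` the number of inversions satisfies
`I_t - I_{ts} < n`, deterministically, for every realization `ω` of the random adjacent
swaps in `l'`. -/
theorem inversion_growth_within_round_lt_n
    (n : ℕ) (init : Equiv.Perm (Fin n)) (ω : ℕ → ℕ) (hω : ∀ k, ω k < n - 1)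
    (ts te : ℕ) (h : isRound init ω ts te) :
    ∀ t : ℕ, ts ≤ t → t ≤ te →
      (invAt init ω t : ℤ) - (invAt init ω ts : ℤ) < (n : ℤ) := by
  have hn : 1 < n := by
    have := hω 0
    omega
  intro t hst hte
  obtain hlt | rfl := hte.lt_or_eq
  · have := invAt_lt_add_outer_index hn h hst hlt
    omega
  · obtain ⟨u, rfl⟩ : ∃ u, t = u + 1 := ⟨t - 1, by have := h.1; omega⟩
    have := invAt_lt_add_outer_index hn h (Nat.lt_succ_iff.mp h.1) (Nat.lt_succ_self u)
    rcases invAt_succ_cases init ω u with ⟨hv, -⟩ | ⟨hv, -⟩ <;> omega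
end

section
/- In the evolving data model, for a round of insertion sort that starts at time t_s and ends at time t_e, and for every time t with t_s ≤ t ≤ t_e, the inequality S_t ≥ I_{t_s} − 2(t − t_s) − B_t holds, where S_t is the number of time steps the current round of insertion sort would still take if no further random adjacent swaps occurred in l', and B_t is the number of bad (stuck plus blocked) inversions at time t. This holds deterministically, for every realization of the random adjacent swaps in l'. -/
open Finset

open scoped Classical

/-- Simulation of the current round with the random swaps in `l'` frozen:
only comparison steps of insertion sort are performed. -/
def frozen {n : ℕ} (s : InsState n) : ℕ → InsState n
  | 0 => s
  | k + 1 => compStep (frozen s k)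

/-- `S_t`: the number of time steps the current round of insertion sort would still
take if no further random adjacent swaps occurred in `l'`, i.e. the least positive
number of frozen comparison steps after which a new round starts. -/
noncomputable def stepsLeft {n : ℕ} (s : InsState n) : ℕ :=
  sInf {k : ℕ | 0 < k ∧ (frozen s k).i = 1 ∧ (frozen s k).j = 1}

/-- Position `c` lies in the semi-sorted portion of `l` (i.e. in `l[0:i]`, excluding
the active element `l[j]`). -/
def semiSorted {n : ℕ} (s : InsState n) (c : Fin n) : Prop :=
  (c : ℕ) ≤ s.i ∧ (c : ℕ) ≠ s.j

/-- `B_t`: the number of bad inversions, i.e. inversions `(l[a], l[b])` (with `a < b`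
and `σ(a) > σ(b)`) that are stuck (`l[b]` is in the semi-sorted portion) or blocked
(`l[b]` is the active element or unsorted, and some semi-sorted `l[c]` with `a < c < b`
has `σ(c) < σ(b)`). -/
noncomputable def badInv {n : ℕ} (s : InsState n) : ℕ :=
  (Finset.univ.filter fun p : Fin n × Fin n =>
      p.1 < p.2 ∧ s.perm p.2 < s.perm p.1 ∧
        (semiSorted s p.2 ∨
          ∃ c : Fin n, semiSorted s c ∧ p.1 < c ∧ c < p.2 ∧ s.perm c < s.perm p.2)).card

theorem swap_lt_swap_of_lt {n : ℕ} {u v a b : Fin n} (huv : (u : ℕ) + 1 = v) (hab : a < b)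
    (hne : ¬ (a = u ∧ b = v)) : Equiv.swap v u a < Equiv.swap v u b := by
  simp only [Equiv.swap_apply_def, Fin.lt_def, Fin.ext_iff] at *
  split_ifs <;> omega

theorem inversions_le_swap_positions {n : ℕ} (σ : Equiv.Perm (Fin n)) {u v : Fin n}
    (huv : (u : ℕ) + 1 = v) :
    inversions σ ≤ inversions ((Equiv.swap v u).trans σ) + 1 := by
  unfold inversions
  refine (tsub_le_iff_right.1 (Finset.pred_card_le_card_erase (a := (u, v)))).trans ?_
  refine Nat.add_le_add_right (Finset.card_le_card_of_injOn
    (fun p => (Equiv.swap v u p.1, Equiv.swap v u p.2)) ?_ ?_) 1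
  · rintro ⟨a, b⟩ hp
    simp only [Finset.coe_erase, Finset.coe_filter, Finset.mem_univ, true_and, Set.mem_sdiff,
      Set.mem_ofPred_eq, Set.mem_singleton_iff, Prod.mk.injEq] at hp
    obtain ⟨⟨hab, hσ⟩, hne⟩ := hp
    refine Finset.mem_coe.2 (Finset.mem_filter.2 ⟨Finset.mem_univ _, ?_⟩)
    simp only [Equiv.trans_apply, Equiv.swap_apply_self]
    exact ⟨swap_lt_swap_of_lt huv hab hne, hσ⟩
  · rintro ⟨a, b⟩ _ ⟨c, d⟩ _ h
    simpa using h

theorem inversions_le_swap_ranks {n : ℕ} (σ : Equiv.Perm (Fin n)) {u v : Fin n}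
    (huv : (u : ℕ) + 1 = v) :
    inversions σ ≤ inversions (σ.trans (Equiv.swap v u)) + 1 := by
  unfold inversions
  refine (tsub_le_iff_right.1 (Finset.pred_card_le_card_erase (a := (σ.symm v, σ.symm u)))).trans ?_
  refine Nat.add_le_add_right (Finset.card_le_card ?_) 1
  rintro ⟨a, b⟩ hp
  simp only [Finset.mem_erase, Finset.mem_filter, Finset.mem_univ, true_and, ne_eq,
    Prod.mk.injEq, Equiv.eq_symm_apply] at hp
  obtain ⟨hne, hab, hσ⟩ := hp
  refine Finset.mem_filter.2 ⟨Finset.mem_univ _, ?_⟩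
  exact ⟨hab, swap_lt_swap_of_lt huv hσ fun h => hne ⟨h.2, h.1⟩⟩

theorem nextI_perm {n : ℕ} (s : InsState n) : (nextI s).perm = s.perm := by
  unfold nextI
  split_ifs <;> rfl

theorem inversions_le_compStep {n : ℕ} (s : InsState n) :
    inversions s.perm ≤ inversions (compStep s).perm + 1 := by
  unfold compStep
  split_ifs with h h'
  · exact inversions_le_swap_positions _ (Nat.sub_add_cancel h.1)
  · simp [nextI_perm]
  · simp [nextI_perm]

theorem inversions_le_randSwap {n : ℕ} (r : ℕ) (σ : Equiv.Perm (Fin n)) :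
    inversions σ ≤ inversions (randSwap r σ) + 1 := by
  unfold randSwap
  split_ifs with h
  · rw [Equiv.swap_comm]
    exact inversions_le_swap_ranks _ rfl
  · exact Nat.le_succ _

theorem invAt_le_add {n : ℕ} (init : Equiv.Perm (Fin n)) (ω : ℕ → ℕ) (t d : ℕ) :
    invAt init ω t ≤ invAt init ω (t + d) + 2 * d := by
  induction d with
  | zero => simp
  | succ d ih =>
    have h₁ := inversions_le_compStep (run init ω (t + d))
    have h₂ := inversions_le_randSwap (ω (t + d)) (compStep (run init ω (t + d))).perm
    have h₃ : invAt init ω (t + (d + 1)) =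
      inversions (randSwap (ω (t + d)) (compStep (run init ω (t + d))).perm) := rfl
    unfold invAt at *
    omega

/-- The loop indices are in the range they have during insertion sort. -/
def IndicesValid {n : ℕ} (s : InsState n) : Prop := 1 ≤ s.i ∧ s.i < n ∧ s.j ≤ s.i

theorem IndicesValid.compStep {n : ℕ} {s : InsState n} (hs : IndicesValid s) :
    IndicesValid (compStep s) := by
  obtain ⟨h₁, h₂, h₃⟩ := hs
  unfold _root_.compStep nextI IndicesValid
  split_ifs <;> simp only [] <;> omega

theorem indicesValid_run {n : ℕ} (hn : 2 ≤ n) (init : Equiv.Perm (Fin n)) (ω : ℕ → ℕ) (t : ℕ) :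
    IndicesValid (run init ω t) := by
  induction t with
  | zero => exact ⟨le_rfl, hn, le_rfl⟩
  | succ t ih => exact ih.compStep

theorem frozen_succ {n : ℕ} (s : InsState n) (k : ℕ) :
    frozen s (k + 1) = frozen (compStep s) k := by
  induction k with
  | zero => rfl
  | succ k ih => exact congrArg compStep ih

theorem exists_frozen_roundStart {n : ℕ} (s : InsState n) (hs : IndicesValid s) :
    ∃ k, 0 < k ∧ (frozen s k).i = 1 ∧ (frozen s k).j = 1 := by
  induction hm : (n - s.i) * (n + 1) + s.j using Nat.strong_induction_on generalizing s with
  | _ m ih =>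
    by_cases hc : (compStep s).i = 1 ∧ (compStep s).j = 1
    · exact ⟨1, one_pos, hc⟩
    · suffices hlt : (n - (compStep s).i) * (n + 1) + (compStep s).j < m by
        obtain ⟨k, -, hk⟩ := ih _ hlt (compStep s) hs.compStep rfl
        exact ⟨k + 1, k.succ_pos, by rwa [frozen_succ]⟩
      subst hm
      obtain ⟨h₁, h₂, h₃⟩ := hs
      have hstep : s.i + 1 < n → (n - s.i) * (n + 1) = (n - (s.i + 1)) * (n + 1) + (n + 1) := by
        intro h
        rw [← Nat.succ_mul]
        congr 1
        omega
      unfold compStep nextI at hc ⊢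
      split_ifs at hc ⊢ <;> simp_all <;> omega

/-- The number of inversions that are neither stuck nor blocked. -/
noncomputable def goodInv {n : ℕ} (s : InsState n) : ℕ :=
  (Finset.univ.filter fun p : Fin n × Fin n =>
      (p.1 < p.2 ∧ s.perm p.2 < s.perm p.1) ∧
        ¬ (semiSorted s p.2 ∨
          ∃ c : Fin n, semiSorted s c ∧ p.1 < c ∧ c < p.2 ∧ s.perm c < s.perm p.2)).card

theorem badInv_add_goodInv {n : ℕ} (s : InsState n) :
    badInv s + goodInv s = inversions s.perm := by
  unfold badInv goodInv inversions
  have h := Finset.card_filter_add_card_filter_not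
    (s := Finset.univ.filter fun p : Fin n × Fin n => p.1 < p.2 ∧ s.perm p.2 < s.perm p.1)
    fun p => semiSorted s p.2 ∨
      ∃ c : Fin n, semiSorted s c ∧ p.1 < c ∧ c < p.2 ∧ s.perm c < s.perm p.2
  simp only [Finset.filter_filter, and_assoc] at h ⊢
  exact h

theorem goodInv_le_swap {n : ℕ} (s : InsState n) {u v : Fin n} (huv : (u : ℕ) + 1 = v)
    (hv : s.j = v) (hi : s.j ≤ s.i) (hlt : s.perm v < s.perm u) :
    goodInv s ≤ goodInv ⟨(Equiv.swap v u).trans s.perm, s.i, u⟩ + 1 := by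
  have hss (c : Fin n) : semiSorted (⟨(Equiv.swap v u).trans s.perm, s.i, u⟩ : InsState n)
      (Equiv.swap v u c) ↔ semiSorted s c := by
    simp only [semiSorted, Equiv.swap_apply_def, Fin.ext_iff]
    split_ifs <;> omega
  unfold goodInv
  refine (tsub_le_iff_right.1 (Finset.pred_card_le_card_erase (a := (u, v)))).trans ?_
  refine Nat.add_le_add_right (Finset.card_le_card_of_injOn
    (fun p => (Equiv.swap v u p.1, Equiv.swap v u p.2)) ?_ ?_) 1
  · rintro ⟨a, b⟩ hp
    simp only [Finset.coe_erase, Finset.coe_filter, Finset.mem_univ, true_and, Set.mem_sdiff,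
      Set.mem_ofPred_eq, Set.mem_singleton_iff, Prod.mk.injEq] at hp
    obtain ⟨⟨⟨hab, hσ⟩, hgood⟩, hne⟩ := hp
    push Not at hgood
    refine Finset.mem_coe.2 (Finset.mem_filter.2 ⟨Finset.mem_univ _, ?_⟩)
    simp only [Equiv.trans_apply, Equiv.swap_apply_self, hss]
    refine ⟨⟨swap_lt_swap_of_lt huv hab hne, hσ⟩, ?_⟩
    rintro (hb | ⟨c', hc', hac, hcb, hlt'⟩)
    · exact hgood.1 hb
    obtain ⟨c, rfl⟩ := (Equiv.swap v u).surjective c'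
    rw [hss] at hc'
    simp only [Equiv.swap_apply_self] at hlt'
    have hac' : a < c := by
      by_contra hca
      refine absurd (hσ.trans ?_) hlt'.not_gt
      have : a = v ∧ c = u := by
        simp only [Equiv.swap_apply_def, Fin.lt_def, Fin.ext_iff] at hac hca ⊢
        split_ifs at hac <;> omega
      rwa [this.1, this.2]
    have hcb' : c < b := by
      have hcv : (c : ℕ) ≠ v := hv ▸ hc'.2
      simp only [Equiv.swap_apply_def, Fin.lt_def, Fin.ext_iff] at hcb ⊢
      split_ifs at hcb <;> omega
    exact absurd hlt' (hgood.2 c hc' hac' hcb').not_gt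
  · rintro ⟨a, b⟩ _ ⟨c, d⟩ _ h
    simpa using h

theorem blocked_active_of_not_lt {n : ℕ} {s : InsState n} (hs : IndicesValid s)
    (hcmp : ∀ h : 0 < s.j ∧ s.j < n, ¬ s.perm ⟨s.j, h.2⟩ < s.perm ⟨s.j - 1, by omega⟩)
    {a b : Fin n} (hb : (b : ℕ) = s.j) (hab : a < b) (hσ : s.perm b < s.perm a) :
    ∃ c : Fin n, semiSorted s c ∧ a < c ∧ c < b ∧ s.perm c < s.perm b := by
  have hj : 0 < s.j ∧ s.j < n := by
    have := b.isLt
    rw [Fin.lt_def] at hab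
    omega
  have hle := not_lt.1 (hcmp hj)
  obtain rfl : b = ⟨s.j, hj.2⟩ := Fin.ext hb
  have hne : s.perm ⟨s.j - 1, by omega⟩ ≠ s.perm ⟨s.j, hj.2⟩ := by
    simp only [ne_eq, EmbeddingLike.apply_eq_iff_eq, Fin.mk.injEq]
    omega
  have hlt := lt_of_le_of_ne hle hne
  have hneq : (a : ℕ) ≠ s.j - 1 := fun h => by
    rw [show a = ⟨s.j - 1, by omega⟩ from Fin.ext h] at hσ
    exact hσ.not_gt hlt
  obtain ⟨-, -, h₃⟩ := hs
  rw [Fin.lt_def] at hab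
  simp only at hab
  exact ⟨⟨s.j - 1, by omega⟩, ⟨by simp only; omega, by simp only; omega⟩,
    Fin.lt_def.2 (by simp only; omega), Fin.lt_def.2 (by simp only; omega), hlt⟩

theorem goodInv_le_advance {n : ℕ} {s : InsState n} (hs : IndicesValid s)
    (hcmp : ∀ h : 0 < s.j ∧ s.j < n, ¬ s.perm ⟨s.j, h.2⟩ < s.perm ⟨s.j - 1, by omega⟩) :
    goodInv s ≤ goodInv ⟨s.perm, s.i + 1, s.i + 1⟩ := by
  unfold goodInv
  refine Finset.card_le_card ?_
  rintro ⟨a, b⟩ hp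
  simp only [Finset.mem_filter, Finset.mem_univ, true_and] at hp ⊢
  obtain ⟨⟨hab, hσ⟩, hgood⟩ := hp
  push Not at hgood
  obtain ⟨hb, hblock⟩ := hgood
  have hbj : (b : ℕ) ≠ s.j := fun h => by
    obtain ⟨c, h₁, h₂, h₃, h₄⟩ := blocked_active_of_not_lt hs hcmp h hab hσ
    exact absurd h₄ (hblock c h₁ h₂ h₃).not_gt
  refine ⟨⟨hab, hσ⟩, ?_⟩
  rintro (hb' | ⟨c, hc, hac, hcb, hlt⟩)
  · exact hb ⟨by have := hb'.1; have := hb'.2; simp only at *; omega, hbj⟩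
  by_cases hcj : (c : ℕ) = s.j
  · obtain ⟨d, h₁, h₂, h₃, h₄⟩ := blocked_active_of_not_lt hs hcmp hcj hac (hlt.trans hσ)
    exact absurd (h₄.trans hlt) (hblock d h₁ h₂ (h₃.trans hcb)).not_gt
  · refine absurd hlt (hblock c ⟨?_, hcj⟩ hac hcb).not_gt
    have := hc.1
    have := hc.2
    simp only at *
    omega

theorem goodInv_eq_zero_of_last {n : ℕ} {s : InsState n} (hs : IndicesValid s)
    (hcmp : ∀ h : 0 < s.j ∧ s.j < n, ¬ s.perm ⟨s.j, h.2⟩ < s.perm ⟨s.j - 1, by omega⟩)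
    (hlast : ¬ s.i + 1 < n) : goodInv s = 0 := by
  unfold goodInv
  rw [Finset.card_eq_zero, Finset.filter_eq_empty_iff]
  rintro ⟨a, b⟩ - ⟨⟨hab, hσ⟩, hgood⟩
  refine hgood ?_
  by_cases hb : (b : ℕ) = s.j
  · exact .inr (blocked_active_of_not_lt hs hcmp hb hab hσ)
  · exact .inl ⟨by have := b.isLt; simp only; omega, hb⟩

theorem goodInv_le_nextI {n : ℕ} {s : InsState n} (hs : IndicesValid s)
    (hcmp : ∀ h : 0 < s.j ∧ s.j < n, ¬ s.perm ⟨s.j, h.2⟩ < s.perm ⟨s.j - 1, by omega⟩) :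
    goodInv s ≤ goodInv (nextI s) := by
  unfold nextI
  split_ifs with hi
  · exact goodInv_le_advance hs hcmp
  · simp [goodInv_eq_zero_of_last hs hcmp hi]

theorem goodInv_le_compStep {n : ℕ} {s : InsState n} (hs : IndicesValid s) :
    goodInv s ≤ goodInv (compStep s) + 1 := by
  unfold compStep
  split_ifs with h h'
  · exact goodInv_le_swap s (Nat.sub_add_cancel h.1) rfl hs.2.2 h'
  · exact (goodInv_le_nextI hs fun _ => h').trans (Nat.le_succ _)
  · exact (goodInv_le_nextI hs fun h' => absurd h' h).trans (Nat.le_succ _)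

theorem goodInv_eq_zero_of_compStep_roundStart {n : ℕ} {s : InsState n} (hs : IndicesValid s)
    (hi : (compStep s).i = 1) (hj : (compStep s).j = 1) : goodInv s = 0 := by
  obtain ⟨h₁, h₂, h₃⟩ := id hs
  unfold compStep nextI at hi hj
  split_ifs at hi hj with h h' h'' h'' <;> simp only at hi hj
  · omega
  · omega
  · exact goodInv_eq_zero_of_last hs (fun _ => h') h''
  · omega
  · exact goodInv_eq_zero_of_last hs (fun h' => absurd h' h) h''

theorem goodInv_le_of_frozen_roundStart {n : ℕ} (k : ℕ) {s : InsState n} (hs : IndicesValid s)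
    (hk : 0 < k) (hi : (frozen s k).i = 1) (hj : (frozen s k).j = 1) : goodInv s ≤ k := by
  induction k generalizing s with
  | zero => exact absurd hk (lt_irrefl 0)
  | succ k ih =>
    rw [frozen_succ] at hi hj
    obtain rfl | hk' := Nat.eq_zero_or_pos k
    · simp [goodInv_eq_zero_of_compStep_roundStart hs hi hj]
    · exact (goodInv_le_compStep hs).trans (Nat.add_le_add_right (ih hs.compStep hk' hi hj) 1)

theorem goodInv_le_stepsLeft {n : ℕ} {s : InsState n} (hs : IndicesValid s) :
    goodInv s ≤ stepsLeft s := by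
  obtain ⟨hk, hi, hj⟩ := Nat.sInf_mem (exists_frozen_roundStart s hs)
  exact goodInv_le_of_frozen_roundStart _ hs hk hi hj

/-- For a round of insertion sort starting at time `ts` and ending at
time `te`, and every `t` with `ts ≤ t ≤ te`, we have `S_t ≥ I_{ts} - 2(t - ts) - B_t`,
deterministically, for every realization `ω` of the random adjacent swaps in `l'`. -/
theorem steps_left_lower_bound
    (n : ℕ) (init : Equiv.Perm (Fin n)) (ω : ℕ → ℕ) (hω : ∀ k, ω k < n - 1)
    (ts te : ℕ) (h : isRound init ω ts te) :
    ∀ t : ℕ, ts ≤ t → t ≤ te →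
      (invAt init ω ts : ℤ) - 2 * ((t : ℤ) - (ts : ℤ)) - (badInv (run init ω t) : ℤ) ≤
        (stepsLeft (run init ω t) : ℤ) := by
  intro t hts _
  have hn : 2 ≤ n := by
    have := hω 0
    omega
  obtain ⟨d, rfl⟩ := Nat.exists_eq_add_of_le hts
  have h₁ := invAt_le_add init ω ts d
  have h₂ := badInv_add_goodInv (run init ω (ts + d))
  have h₃ := goodInv_le_stepsLeft (indicesValid_run hn init ω (ts + d))
  have h₄ : invAt init ω (ts + d) = inversions (run init ω (ts + d)).perm := rfl
  push_cast
  omega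
end

section
/- Let c > e be a constant. Suppose ⌈c·n⌉ balls are thrown independently and uniformly at random into n bins, and let X_k denote the number of balls in bin k. Then there exist constants γ > 0 and N such that for all n ≥ N, the probability that Σ_{k=1}^{n} X_k² ≥ 3c²·n is at most e^{−γ·n^{1/6}}. In particular, the sum over the bins of the square of the number of balls in each bin is at most 3c²·n with exponentially high probability. -/
open Finset

open scoped Classical

namespace BallsInBins

/-- The number of balls in bin `k` under the assignment `a`. -/
def load {m n : ℕ} (a : Fin m → Fin n) (k : Fin n) : ℕ :=
  (Finset.univ.filter fun i => a i = k).card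

/-- The sum of the squares of the bin loads. -/
def sumSq {m n : ℕ} (a : Fin m → Fin n) : ℝ :=
  ∑ k : Fin n, (load a k : ℝ) ^ 2

lemma load_cons {m n : ℕ} (j : Fin n) (a : Fin m → Fin n) (k : Fin n) :
    load (Fin.cons j a : Fin (m + 1) → Fin n) k = (if j = k then 1 else 0) + load a k := by
  simp only [load, Finset.card_filter, Fin.sum_univ_succ, Fin.cons_zero, Fin.cons_succ]

lemma sum_load {m n : ℕ} (a : Fin m → Fin n) : ∑ k, (load a k : ℝ) = m := by
  have h := Finset.card_eq_sum_card_fiberwise (s := univ) (t := univ) (f := a)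
    (fun _ _ => by simp)
  rw [Finset.card_univ, Fintype.card_fin] at h
  exact_mod_cast h.symm

lemma sumSq_cons {m n : ℕ} (j : Fin n) (a : Fin m → Fin n) :
    sumSq (Fin.cons j a : Fin (m + 1) → Fin n) = sumSq a + 2 * load a j + 1 := by
  have h : ∀ k, (load (Fin.cons j a : Fin (m + 1) → Fin n) k : ℝ) ^ 2 =
      (load a k : ℝ) ^ 2 + if j = k then 2 * (load a k : ℝ) + 1 else 0 := by
    intro k
    rw [load_cons]
    split_ifs
    · push_cast; ring
    · push_cast; ring
  simp only [sumSq, h, Finset.sum_add_distrib, Finset.sum_ite_eq, Finset.mem_univ, if_true]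
  ring

lemma sum_fin_succ {m n : ℕ} (f : (Fin (m + 1) → Fin n) → ℝ) :
    ∑ a, f a = ∑ a : Fin m → Fin n, ∑ j : Fin n, f (Fin.cons j a) := by
  rw [← (Fin.consEquiv fun _ => Fin n).sum_comp, Fintype.sum_prod_type, Finset.sum_comm]
  rfl

lemma exp_le_one_add_two_mul {x : ℝ} (h₀ : 0 ≤ x) (h₁ : x ≤ 1) : Real.exp x ≤ 1 + 2 * x := by
  have h := Real.abs_exp_sub_one_sub_id_le (x := x) (by rwa [abs_of_nonneg h₀])
  have := (abs_le.1 h).2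
  nlinarith

/-- The exponential moment of `sumSq`, restricted to assignments with all loads at most `L`. -/
lemma sum_exp_sumSq_le {n : ℕ} (hn : 0 < n) {L t : ℝ} (ht : 0 ≤ t) (htL : 2 * t * L ≤ 1) (m : ℕ) :
    ∑ a : Fin m → Fin n, (if ∀ k, (load a k : ℝ) ≤ L then Real.exp (t * sumSq a) else 0) ≤
      (n : ℝ) ^ m * Real.exp (t * (m + 2 * m ^ 2 / n)) := by
  have hn' : (0 : ℝ) < n := by exact_mod_cast hn
  induction m with
  | zero =>
    rw [Fintype.sum_unique]
    split_ifs
    · simp [sumSq, load]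
    · simp
  | succ m ih =>
    have step : ∀ a : Fin m → Fin n,
        ∑ j, (if ∀ k, (load (Fin.cons j a : Fin (m + 1) → Fin n) k : ℝ) ≤ L then
          Real.exp (t * sumSq (Fin.cons j a : Fin (m + 1) → Fin n)) else 0) ≤
        (if ∀ k, (load a k : ℝ) ≤ L then Real.exp (t * sumSq a) else 0) *
          (n * Real.exp (t * (1 + 4 * m / n))) := by
      intro a
      by_cases ha : ∀ k, (load a k : ℝ) ≤ L
      · rw [if_pos ha]
        calc _ ≤ ∑ j, Real.exp (t * sumSq a) * Real.exp t * (1 + 4 * t * load a j) := by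
              refine Finset.sum_le_sum fun j _ => ?_
              have hj : (0 : ℝ) ≤ load a j := Nat.cast_nonneg _
              have h1 : Real.exp (2 * t * load a j) ≤ 1 + 2 * (2 * t * load a j) :=
                exp_le_one_add_two_mul (by positivity)
                  (le_trans (mul_le_mul_of_nonneg_left (ha j) (by positivity)) htL)
              split_ifs
              · rw [sumSq_cons, show t * (sumSq a + 2 * load a j + 1) =
                  t * sumSq a + t + 2 * t * load a j by ring, Real.exp_add, Real.exp_add]
                gcongr
                linarith
              · positivity
          _ = Real.exp (t * sumSq a) * (n * (Real.exp t * (4 * t * m / n + 1))) := by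
              rw [← Finset.mul_sum, Finset.sum_add_distrib, ← Finset.mul_sum, sum_load]
              simp only [Finset.sum_const, Finset.card_univ, Fintype.card_fin, nsmul_eq_mul]
              field_simp
              ring
          _ ≤ _ := by
              gcongr
              rw [show t * (1 + 4 * m / n) = t + 4 * t * m / n by ring, Real.exp_add]
              gcongr
              exact Real.add_one_le_exp _
      · rw [if_neg ha, zero_mul]
        refine (Finset.sum_eq_zero fun j _ => if_neg fun h => ha fun k => ?_).le
        refine le_trans ?_ (h k)
        rw [load_cons]
        exact_mod_cast Nat.le_add_left _ _
    rw [sum_fin_succ]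
    calc _ ≤ _ := Finset.sum_le_sum fun a _ => step a
      _ ≤ (n : ℝ) ^ m * Real.exp (t * (m + 2 * m ^ 2 / n)) *
          (n * Real.exp (t * (1 + 4 * m / n))) := by
        rw [← Finset.sum_mul]
        gcongr
      _ = (n : ℝ) ^ (m + 1) * Real.exp (t * (m + 2 * m ^ 2 / n) + t * (1 + 4 * m / n)) := by
        rw [Real.exp_add]; ring
      _ ≤ _ := by
        rw [← mul_add]
        refine mul_le_mul_of_nonneg_left
          (Real.exp_le_exp.2 (mul_le_mul_of_nonneg_left ?_ ht)) (by positivity)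
        push_cast
        have : 0 ≤ 2 / (n : ℝ) := by positivity
        have e : ((m : ℝ) + 1 + 2 * (m + 1) ^ 2 / n) -
          (m + 2 * m ^ 2 / n + (1 + 4 * m / n)) = 2 / n := by ring
        linarith

lemma sum_exp_load_le {n : ℕ} (hn : 0 < n) (m : ℕ) (k : Fin n) :
    ∑ a : Fin m → Fin n, Real.exp (load a k) ≤ (n : ℝ) ^ m * Real.exp (2 * m / n) := by
  have hn' : (0 : ℝ) < n := by exact_mod_cast hn
  have h : ∀ a : Fin m → Fin n,
      Real.exp (load a k) = ∏ i, (if a i = k then Real.exp 1 else 1) := by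
    intro a
    rw [Finset.prod_ite, Finset.prod_const, Finset.prod_const_one, mul_one, ← Real.exp_nat_mul,
      mul_one]
    rfl
  have hs : ∑ j : Fin n, (if j = k then Real.exp 1 else 1) ≤ n * Real.exp (2 / n) := by
    have e : ∀ j : Fin n, (if j = k then Real.exp 1 else 1) =
        1 + if j = k then Real.exp 1 - 1 else 0 := by
      intro j; split_ifs <;> ring
    simp only [e, Finset.sum_add_distrib, Finset.sum_ite_eq', Finset.mem_univ, if_true,
      Finset.sum_const, Finset.card_univ, Fintype.card_fin, nsmul_eq_mul, mul_one]
    have h2 := mul_le_mul_of_nonneg_left (Real.add_one_le_exp (2 / (n : ℝ))) hn'.le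
    have h3 : (n : ℝ) * (2 / n + 1) = 2 + n := by field_simp
    have := Real.exp_one_lt_d9
    linarith
  calc _ = (∑ j : Fin n, (if j = k then Real.exp 1 else 1)) ^ m := by
        rw [Fintype.sum_pow]; exact Finset.sum_congr rfl fun a _ => h a
    _ ≤ (n * Real.exp (2 / n)) ^ m :=
        pow_le_pow_left₀ (Finset.sum_nonneg fun j _ => by split_ifs <;> positivity) hs m
    _ = _ := by
        rw [mul_pow, ← Real.exp_nat_mul]
        congr 2; ring

lemma card_le_sumSq_le {n : ℕ} (hn : 0 < n) {L t : ℝ} (ht : 0 ≤ t) (htL : 2 * t * L ≤ 1)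
    (m : ℕ) (s : ℝ) :
    ((univ.filter fun a : Fin m → Fin n => s ≤ sumSq a).card : ℝ) ≤
      (n : ℝ) ^ m * (Real.exp (t * (m + 2 * m ^ 2 / n - s)) +
        n * Real.exp (2 * m / n - L)) := by
  have key : ∀ a : Fin m → Fin n, (if s ≤ sumSq a then (1 : ℝ) else 0) ≤
      Real.exp (-(t * s)) *
        (if ∀ k, (load a k : ℝ) ≤ L then Real.exp (t * sumSq a) else 0) +
      Real.exp (-L) * ∑ k, Real.exp (load a k) := by
    intro a
    have hnn : 0 ≤ Real.exp (-L) * ∑ k, Real.exp (load a k) := by positivity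
    by_cases hs : s ≤ sumSq a
    · rw [if_pos hs]
      by_cases ha : ∀ k, (load a k : ℝ) ≤ L
      · rw [if_pos ha, ← Real.exp_add]
        have : 1 ≤ Real.exp (-(t * s) + t * sumSq a) :=
          Real.one_le_exp (by nlinarith)
        linarith
      · rw [if_neg ha, mul_zero, zero_add]
        push Not at ha
        obtain ⟨k, hk⟩ := ha
        calc (1 : ℝ) ≤ Real.exp (-L + load a k) := Real.one_le_exp (by linarith)
          _ = Real.exp (-L) * Real.exp (load a k) := Real.exp_add _ _
          _ ≤ _ := by
            gcongr
            exact Finset.single_le_sum (f := fun k => Real.exp (load a k : ℝ))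
              (fun _ _ => (Real.exp_pos _).le) (mem_univ k)
    · rw [if_neg hs]
      split_ifs <;> positivity
  rw [Finset.card_filter]
  push_cast
  calc _ ≤ _ := Finset.sum_le_sum fun a _ => key a
    _ ≤ Real.exp (-(t * s)) * ((n : ℝ) ^ m * Real.exp (t * (m + 2 * m ^ 2 / n))) +
        Real.exp (-L) * ∑ _k : Fin n, (n : ℝ) ^ m * Real.exp (2 * m / n) := by
      rw [Finset.sum_add_distrib, ← Finset.mul_sum, ← Finset.mul_sum, Finset.sum_comm]
      gcongr
      · exact sum_exp_sumSq_le hn ht htL m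
      · exact sum_exp_load_le hn m _
    _ = _ := by
      rw [Finset.sum_const, Finset.card_univ, Fintype.card_fin, nsmul_eq_mul,
        mul_sub, sub_eq_add_neg, sub_eq_add_neg, Real.exp_add, Real.exp_add]
      ring

/-- Comparison of the two tail terms with `exp (-x)`, where `x` plays the role of `n ^ (1/6)`. -/
lemma exp_add_pow_mul_exp_le {d x : ℝ} (hd : 0 ≤ d) (hx : d + 10 ≤ x) :
    Real.exp (-(x ^ 3 / 2)) + x ^ 6 * Real.exp (d - x ^ 3) ≤ Real.exp (-x) := by
  have hx0 : 0 ≤ x := by linarith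
  have hcube : 100 * x ≤ x ^ 3 := by nlinarith [mul_nonneg hx0 (sq_nonneg x)]
  have htwo : (2 : ℝ) ≤ Real.exp 1 := by linarith [Real.exp_one_gt_d9]
  have hhalf : Real.exp (-x - 1) ≤ Real.exp (-x) / 2 := by
    rw [Real.exp_sub]
    gcongr
  have h1 : Real.exp (-(x ^ 3 / 2)) ≤ Real.exp (-x) / 2 :=
    le_trans (Real.exp_le_exp.2 (by linarith)) hhalf
  have hpow : x ^ 6 ≤ Real.exp (10 + x) := by
    have h := Real.pow_div_factorial_le_exp x hx0 6
    have h720 : (720 : ℝ) ≤ Real.exp 10 := by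
      have : (2 : ℝ) ^ 10 ≤ Real.exp 1 ^ 10 := by gcongr
      rw [← Real.exp_nat_mul] at this
      norm_num at this
      linarith
    rw [div_le_iff₀ (by positivity)] at h
    norm_num [Nat.factorial] at h
    rw [Real.exp_add]
    nlinarith [Real.exp_pos x]
  have h2 : x ^ 6 * Real.exp (d - x ^ 3) ≤ Real.exp (-x) / 2 := by
    calc _ ≤ Real.exp (10 + x) * Real.exp (d - x ^ 3) := by gcongr
      _ = Real.exp (10 + x + (d - x ^ 3)) := (Real.exp_add _ _).symm
      _ ≤ Real.exp (-x - 1) := Real.exp_le_exp.2 (by linarith)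
      _ ≤ _ := hhalf
  linarith

end BallsInBins

open BallsInBins

/-- Let `c > e`.  If `⌈c n⌉` balls are thrown independently and
uniformly at random into `n` bins and `X_k` is the number of balls in bin `k`, then
there are constants `γ > 0` and `N` such that for all `n ≥ N`, the probability that
`Σ_k X_k² ≥ 3 c² n` is at most `e^{-γ n^{1/6}}` (probability measured by counting the
bad assignments of balls to bins among all `n^{⌈c n⌉}` equally likely assignments). -/
theorem balls_in_bins_sum_of_squares
    (c : ℝ) (hc : Real.exp 1 < c) :
    ∃ γ : ℝ, 0 < γ ∧ ∃ N : ℕ, ∀ n : ℕ, N ≤ n →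
      ((Finset.univ.filter fun a : Fin ⌈c * (n : ℝ)⌉₊ → Fin n =>
          3 * c ^ 2 * (n : ℝ) ≤
            ∑ k : Fin n, ((Finset.univ.filter fun i => a i = k).card : ℝ) ^ 2).card : ℝ) ≤
        Real.exp (-γ * (n : ℝ) ^ ((1 : ℝ) / 6)) * (n : ℝ) ^ (⌈c * (n : ℝ)⌉₊ : ℕ) := by
  have hc2 : 2 < c := by linarith [Real.exp_one_gt_d9]
  refine ⟨1, one_pos, ⌈(2 * c + 2 + 10) ^ 6⌉₊, fun n hN => ?_⟩
  set x : ℝ := (n : ℝ) ^ ((1 : ℝ) / 6) with hx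
  have hx0 : 0 ≤ x := by positivity
  have hx6 : x ^ 6 = n := by
    rw [hx, ← Real.rpow_natCast, ← Real.rpow_mul (Nat.cast_nonneg n)]
    norm_num
  have hxc : 2 * c + 2 + 10 ≤ x := by
    refine le_of_pow_le_pow_left₀ (n := 6) (by norm_num) hx0 ?_
    rw [hx6]
    exact Nat.ceil_le.1 hN
  have hxn : x ≤ n := by
    rw [← hx6]
    exact le_self_pow₀ (by linarith) (by norm_num)
  have hn0 : (0 : ℝ) < n := by linarith
  have hn : 0 < n := by exact_mod_cast hn0
  have hxpos : 0 < x := by linarith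
  set m := ⌈c * (n : ℝ)⌉₊
  have hm : (m : ℝ) ≤ c * n + 1 := (Nat.ceil_lt_add_one (by positivity)).le
  have hmn : (m : ℝ) / n ≤ c + 1 := by
    rw [div_le_iff₀ hn0]
    linarith
  have hmean : (m : ℝ) + 2 * m ^ 2 / n - 3 * c ^ 2 * n ≤ -n := by
    have h1 : (m : ℝ) ^ 2 / n ≤ c ^ 2 * n + 2 * c + 1 := by
      rw [div_le_iff₀ hn0]
      calc (m : ℝ) ^ 2 ≤ (c * n + 1) ^ 2 := by gcongr
        _ ≤ _ := by nlinarith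
    rw [mul_div_assoc]
    nlinarith [mul_pos (sub_pos.2 hc2) hn0, mul_pos (mul_pos (sub_pos.2 hc2) hn0)
      (by linarith : 0 < c)]
  have ht : 2 * (1 / (2 * x ^ 3)) * x ^ 3 ≤ 1 := by
    refine le_of_eq ?_
    field_simp
  refine le_trans (card_le_sumSq_le hn (by positivity) ht m (3 * c ^ 2 * n)) ?_
  rw [mul_comm, neg_one_mul]
  gcongr
  refine le_trans (add_le_add ?_ ?_)
    (exp_add_pow_mul_exp_le (d := 2 * c + 2) (by linarith) hxc)
  · rw [Real.exp_le_exp]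
    refine le_trans (mul_le_mul_of_nonneg_left hmean (by positivity)) (le_of_eq ?_)
    rw [← hx6]
    field_simp
  · rw [hx6, mul_div_assoc]
    gcongr
    linarith
end
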